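/- arXiv:0808.4058 — 2 statements merged into one kernel-verified Lean document; each statement's English description precedes it below -/
import Mathlib

section
/- Let A be a commutative ℚ-algebra, B a commutative ring, and φ : A → B[u,u⁻¹] a ring homomorphism into the ring of Laurent polynomials over B. For i ∈ ℤ put F^i := {x ∈ A : φ(x) = 0 or deg φ(x) ≤ −i}. For b ∈ A and k ∈ ℕ, let C(b,k) := (1/k!)·b·(b−1)⋯(b−k+1) ∈ A. Suppose a, b ∈ A and there exist integers α and β with β ≥ 0 and α + β < 0 such that deg φ(a) ≤ α and deg φ(b) ≤ β (these conditions being regarded as automatically satisfied when φ(a), respectively φ(b), is zero). Then for every i ∈ ℤ there exists K₀ ∈ ℕ such that C(b,k)·a^k ∈ F^i for all k ≥ K₀; consequently the partial sums S_K := Σ_{k=0}^{K} C(b,k)·a^k satisfy S_{K'} − S_K ∈ F^i for all K' ≥ K ≥ K₀, i.e. they form a Cauchy sequence for the linear topology on A defined by the subgroups (F^i)_{i∈ℤ}. -/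
theorem degle_iff {B : Type*} [CommRing B] (f : LaurentPolynomial B) (n : ℤ) :
    f.degree ≤ ((n : ℤ) : WithBot ℤ) ↔ ∀ m : ℤ, n < m → f.coeff m = 0 := by
  rw [LaurentPolynomial.degree, Finset.max_eq_sup_withBot, Finset.sup_le_iff]
  constructor
  · intro h m hm
    by_contra hne
    have := h m (Finsupp.mem_support_iff.2 hne)
    have := WithBot.coe_le_coe.1 this
    omega
  · intro h m hm
    refine WithBot.coe_le_coe.2 ?_
    by_contra hlt
    exact (Finsupp.mem_support_iff.1 hm) (h m (by omega))

theorem degle_mul {B : Type*} [CommRing B] (f g : LaurentPolynomial B) (n m : ℤ)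
    (hf : f.degree ≤ ((n : ℤ) : WithBot ℤ)) (hg : g.degree ≤ ((m : ℤ) : WithBot ℤ)) :
    (f * g).degree ≤ ((n + m : ℤ) : WithBot ℤ) := by
  rw [degle_iff] at *
  intro l hl
  rw [AddMonoidAlgebra.coeff_mul]
  refine Finset.sum_eq_zero fun p _ => Finset.sum_eq_zero fun q _ => ?_
  dsimp only
  split_ifs with h
  · by_cases hp : n < p
    · rw [hf p hp, zero_mul]
    · rw [hg q (by omega), mul_zero]
  · rfl

theorem degle_sub {B : Type*} [CommRing B] (f g : LaurentPolynomial B) (n : ℤ)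
    (hf : f.degree ≤ ((n : ℤ) : WithBot ℤ)) (hg : g.degree ≤ ((n : ℤ) : WithBot ℤ)) :
    (f - g).degree ≤ ((n : ℤ) : WithBot ℤ) := by
  rw [degle_iff] at *
  intro l hl
  have := hf l hl
  have := hg l hl
  simp [*]

theorem degle_sum {B ι : Type*} [CommRing B] (s : Finset ι) (f : ι → LaurentPolynomial B) (n : ℤ)
    (hf : ∀ i ∈ s, (f i).degree ≤ ((n : ℤ) : WithBot ℤ)) :
    (∑ i ∈ s, f i).degree ≤ ((n : ℤ) : WithBot ℤ) := by
  rw [degle_iff]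
  intro l hl
  rw [AddMonoidAlgebra.coeff_sum, Finsupp.finsetSum_apply]
  exact Finset.sum_eq_zero fun i hi => (degle_iff _ _).1 (hf i hi) l hl

theorem degle_C {B : Type*} [CommRing B] (c : B) (n : ℤ) (hn : 0 ≤ n) :
    (LaurentPolynomial.C c).degree ≤ ((n : ℤ) : WithBot ℤ) :=
  (LaurentPolynomial.degree_C_le c).trans (WithBot.coe_le_coe.2 hn)

theorem degle_inv {B : Type*} [CommRing B] (N : ℕ) (f : LaurentPolynomial B)
    (h : (N : LaurentPolynomial B) * f = 1) :
    f.degree ≤ ((0 : ℤ) : WithBot ℤ) := by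
  rw [← nsmul_eq_mul] at h
  have hc : ∀ m : ℤ, (N : B) * f.coeff m = (1 : LaurentPolynomial B).coeff m := by
    intro m
    rw [← h, ← nsmul_eq_mul, AddMonoidAlgebra.coeff_smul_apply]
  have h0 := hc 0
  rw [AddMonoidAlgebra.coeff_one_zero] at h0
  rw [degle_iff]
  intro m hm
  have h1 := hc m
  rw [← map_one LaurentPolynomial.C, LaurentPolynomial.C_apply, if_neg (by omega)] at h1
  calc f.coeff m = ((N : B) * f.coeff 0) * f.coeff m := by rw [h0, one_mul]
    _ = ((N : B) * f.coeff m) * f.coeff 0 := by ring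
    _ = 0 := by rw [h1, zero_mul]

/-- Let `A` be a commutative `ℚ`-algebra, `φ : A → B[u,u⁻¹]` a ring
homomorphism into Laurent polynomials, and `F i := {x | φ x = 0 or deg φ x ≤ -i}`.
If `deg φ a ≤ α`, `deg φ b ≤ β` with `β ≥ 0` and `α + β < 0`, then for every `i`
the terms `C(b,k)·a^k` (with `C(b,k) := (1/k!)·b(b−1)⋯(b−k+1)`) eventually lie in
`F i`, and the partial sums `S_K := ∑_{k≤K} C(b,k)·a^k` are Cauchy for the linear
topology defined by the filtration `(F i)`. -/
theorem statement6 {A B : Type*} [CommRing A] [Algebra ℚ A] [CommRing B]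
    (φ : A →+* LaurentPolynomial B)
    (F : ℤ → Set A)
    (hF : ∀ (i : ℤ) (x : A), x ∈ F i ↔ (φ x).degree ≤ ((-i : ℤ) : WithBot ℤ))
    (Cb : A → ℕ → A)
    (hCb : ∀ (b : A) (k : ℕ),
      Cb b k = (k.factorial : ℚ)⁻¹ • ∏ j ∈ Finset.range k, (b - (j : A)))
    (a b : A) (α β : ℤ) (hβ : 0 ≤ β) (hαβ : α + β < 0)
    (ha : (φ a).degree ≤ ((α : ℤ) : WithBot ℤ))
    (hb : (φ b).degree ≤ ((β : ℤ) : WithBot ℤ)) :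
    ∀ i : ℤ, ∃ K₀ : ℕ,
      (∀ k : ℕ, K₀ ≤ k → Cb b k * a ^ k ∈ F i) ∧
      (∀ K K' : ℕ, K₀ ≤ K → K ≤ K' →
        (∑ k ∈ Finset.range (K' + 1), Cb b k * a ^ k) -
            (∑ k ∈ Finset.range (K + 1), Cb b k * a ^ k) ∈ F i) := by
  intro i
  have hprod : ∀ k : ℕ, (φ (∏ j ∈ Finset.range k, (b - (j : A)))).degree
      ≤ ((k * β : ℤ) : WithBot ℤ) := by
    intro k
    induction k with
    | zero => simpa using degle_C (1 : B) 0 le_rfl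
    | succ k ih =>
      rw [Finset.prod_range_succ, map_mul]
      have := degle_mul _ (φ (b - (k : A))) _ β ih (by
        rw [map_sub, map_natCast]
        refine degle_sub _ _ _ hb ?_
        rw [← map_natCast (LaurentPolynomial.C : B →+* _)]
        exact degle_C _ _ hβ)
      convert this using 2
      push_cast; ring
  have hpow : ∀ k : ℕ, (φ (a ^ k)).degree ≤ ((k * α : ℤ) : WithBot ℤ) := by
    intro k
    induction k with
    | zero => simpa using degle_C (1 : B) 0 le_rfl
    | succ k ih =>
      rw [pow_succ, map_mul]
      convert degle_mul _ _ _ _ ih ha using 2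
      push_cast; ring
  have hterm : ∀ k : ℕ, i.toNat ≤ k →
      (φ (Cb b k * a ^ k)).degree ≤ ((-i : ℤ) : WithBot ℤ) := by
    intro k hk
    have hinv : (φ (algebraMap ℚ A (k.factorial : ℚ)⁻¹)).degree ≤ ((0 : ℤ) : WithBot ℤ) := by
      apply degle_inv k.factorial
      rw [← map_natCast φ, ← map_mul, ← map_natCast (algebraMap ℚ A), ← map_mul,
        mul_inv_cancel₀ (by exact_mod_cast k.factorial_ne_zero), map_one, map_one]
    rw [hCb, Algebra.smul_def, map_mul, map_mul]
    refine (degle_mul _ _ _ _ (degle_mul _ _ _ _ hinv (hprod k)) (hpow k)).trans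
      (WithBot.coe_le_coe.2 ?_)
    have : i ≤ k := by omega
    nlinarith
  refine ⟨i.toNat, fun k hk => (hF _ _).2 (hterm k hk), fun K K' hK hKK' => (hF _ _).2 ?_⟩
  rw [← Finset.sum_Ico_eq_sub _ (by omega : K + 1 ≤ K' + 1), map_sum]
  refine degle_sum _ _ _ fun k hk => hterm k ?_
  have := (Finset.mem_Ico.1 hk).1
  omega
end

section
/- Let G be a finite group and ρ : G → GL(V) a representation of G on a finite-dimensional ℚ-vector space V. Let I and D be subgroups of G with I normal in D and with D/I cyclic. Let V^I denote the subspace of vectors of V fixed by ρ(i) for all i ∈ I; then V^I is stable under ρ(d) for every d ∈ D, and the induced action of D on V^I factors through D/I. If g and g' are two elements of D whose images in D/I both generate D/I, then the restrictions of ρ(g) and ρ(g') to V^I have the same characteristic polynomial; equivalently, the polynomial det(Id − t·ρ(g)|_{V^I}) ∈ ℚ[t] does not depend on the choice of an element g of D whose image generates D/I. -/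
open Polynomial in
/-- An endomorphism of finite order over an algebraically closed field of characteristic zero
has a basis of eigenvectors. -/
theorem exists_eigenbasis {K W : Type*} [Field K] [CharZero K] [IsAlgClosed K] [AddCommGroup W]
    [Module K W] [FiniteDimensional K W] (f : Module.End K W) (n : ℕ) (hn : n ≠ 0)
    (hf : f ^ n = 1) :
    ∃ (d : ℕ) (b : Module.Basis (Fin d) K W) (μ : Fin d → K), ∀ i, f (b i) = μ i • b i := by
  classical
  have hss : f.IsSemisimple := by
    refine Module.End.isSemisimple_of_squarefree_aeval_eq_zero (p := (X ^ n - 1 : K[X])) ?_ ?_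
    · exact (X_pow_sub_one_separable_iff.mpr (by exact_mod_cast hn)).squarefree
    · simp [hf]
  have htop := hss.iSup_maxGenEigenspace_eq_top_iff.mp f.iSup_maxGenEigenspace_eq_top
  have hint : DirectSum.IsInternal f.eigenspace :=
    DirectSum.isInternal_submodule_of_iSupIndep_of_iSup_eq_top f.eigenspaces_iSupIndep htop
  let b := hint.collectedBasis fun μ => Module.finBasis K (f.eigenspace μ)
  have : Finite (Σ μ, Fin (Module.finrank K (f.eigenspace μ))) := Module.Finite.finite_basis b
  have := Fintype.ofFinite (Σ μ, Fin (Module.finrank K (f.eigenspace μ)))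
  let e := Fintype.equivFin (Σ μ, Fin (Module.finrank K (f.eigenspace μ)))
  refine ⟨_, b.reindex e, fun i => (e.symm i).1, fun i => ?_⟩
  rw [Module.Basis.reindex_apply]
  exact Module.End.mem_eigenspace_iff.mp (hint.collectedBasis_mem _ _)

open Polynomial in
theorem charpoly_of_eigenbasis {K W : Type*} [Field K] [AddCommGroup W]
    [Module K W] [FiniteDimensional K W] (f : Module.End K W) {d : ℕ}
    (b : Module.Basis (Fin d) K W) (μ : Fin d → K) (h : ∀ i, f (b i) = μ i • b i) :
    f.charpoly = ∏ i, (X - C (μ i)) := by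
  rw [← LinearMap.charpoly_toMatrix f b, ← Matrix.charpoly_diagonal]
  congr 1
  ext i j
  rw [LinearMap.toMatrix_apply, h]
  by_cases hij : i = j
  · subst hij; simp
  · simp [Matrix.diagonal_apply_ne _ hij, Ne.symm hij]

theorem exists_galois (K : Type*) [Field K] [CharZero K] [IsAlgClosed K] [Algebra ℚ K]
    [Algebra.IsAlgebraic ℚ K] (n m : ℕ) (hn : n ≠ 0) (hm : m.Coprime n) :
    ∃ σ : K ≃ₐ[ℚ] K, ∀ x, x ^ n = 1 → σ x = x ^ m := by
  have : NeZero n := ⟨hn⟩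
  obtain ⟨ζ, hζ⟩ := HasEnoughRootsOfUnity.exists_primitiveRoot K n
  have : IsAlgClosure ℚ K := ⟨inferInstance, inferInstance⟩
  have : Normal ℚ K := IsAlgClosure.normal ℚ K
  have hint := hζ.isIntegral (Nat.pos_of_ne_zero hn)
  have h : IsConjRoot ℚ (ζ ^ m) ζ := by
    rw [isConjRoot_def, minpoly.isIntegrallyClosed_eq_field_fractions' ℚ hint,
      minpoly.isIntegrallyClosed_eq_field_fractions' ℚ (hint.pow m),
      hζ.minpoly_eq_pow_coprime hm]
  obtain ⟨σ, hσ⟩ := isConjRoot_iff_exists_algEquiv.mp h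
  refine ⟨σ, fun x hx => ?_⟩
  obtain ⟨i, -, rfl⟩ := hζ.eq_pow_of_pow_eq_one hx
  rw [map_pow, hσ, ← pow_mul, ← pow_mul, mul_comm]

open Polynomial in
theorem charpoly_pow_aux (K : Type*) [Field K] [CharZero K] [IsAlgClosed K] [Algebra ℚ K]
    [Algebra.IsAlgebraic ℚ K] {W : Type*} [AddCommGroup W] [Module ℚ W] [FiniteDimensional ℚ W]
    (f : Module.End ℚ W) (n m : ℕ) (hn : n ≠ 0) (hm : m.Coprime n) (hf : f ^ n = 1) :
    f.charpoly = (f ^ m).charpoly := by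
  obtain ⟨σ, hσ⟩ := exists_galois K n m hn hm
  apply Polynomial.map_injective (algebraMap ℚ K) (algebraMap ℚ K).injective
  have hF : (f.baseChange K) ^ n = 1 := by
    rw [← LinearMap.baseChange_pow, hf, LinearMap.baseChange_one]
  obtain ⟨d, b, μ, hb⟩ := exists_eigenbasis (f.baseChange K) n hn hF
  have hpow : ∀ k i, ((f.baseChange K) ^ k) (b i) = μ i ^ k • b i := by
    intro k i
    induction k with
    | zero => simp
    | succ k ih => rw [pow_succ', Module.End.mul_apply, ih, map_smul, hb, smul_smul, pow_succ]
  have hμ : ∀ i, μ i ^ n = 1 := by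
    intro i
    have h := hpow n i
    rw [hF, Module.End.one_apply] at h
    have h2 := congrArg (fun v => b.repr v i) h
    simpa using h2.symm
  have h1 : f.charpoly.map (algebraMap ℚ K) = ∏ i, (X - C (μ i)) := by
    rw [← LinearMap.charpoly_baseChange]
    exact charpoly_of_eigenbasis _ b μ hb
  have h2 : (f ^ m).charpoly.map (algebraMap ℚ K) = ∏ i, (X - C (μ i ^ m)) := by
    rw [← LinearMap.charpoly_baseChange, LinearMap.baseChange_pow]
    exact charpoly_of_eigenbasis _ b _ (hpow m)
  have h3 : (f.charpoly.map (algebraMap ℚ K)).map (σ : K →+* K)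
      = f.charpoly.map (algebraMap ℚ K) := by
    rw [Polynomial.map_map]
    congr 1
    exact Subsingleton.elim _ _
  rw [h2, ← h3, h1, Polynomial.map_prod]
  refine Finset.prod_congr rfl fun i _ => ?_
  simp [hσ _ (hμ i)]

theorem charpoly_pow_of_coprime {W : Type*} [AddCommGroup W] [Module ℚ W] [FiniteDimensional ℚ W]
    (f : Module.End ℚ W) (n m : ℕ) (hn : n ≠ 0) (hm : m.Coprime n) (hf : f ^ n = 1) :
    f.charpoly = (f ^ m).charpoly :=
  @charpoly_pow_aux (AlgebraicClosure ℚ) _ _ _ (AlgebraicClosure.instAlgebra ℚ)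
    (AlgebraicClosure.isAlgebraic ℚ) W _ _ _ f n m hn hm hf


/-- Let `G` be a finite group, `ρ` a representation of `G` on a
finite-dimensional `ℚ`-vector space `V`, and `I ≤ D` subgroups of `G` with `I`
normal in `D` and `D/I` cyclic. Then the subspace `V^I` of `I`-invariants is stable
under `ρ d` for all `d ∈ D`, the induced action of `D` on `V^I` factors through
`D/I`, and for any two elements `g, g'` of `D` whose images in `D/I` generate `D/I`,
the restrictions of `ρ g` and `ρ g'` to `V^I` have the same characteristic
polynomial. -/
theorem statement8 {G : Type*} [Group G] [Finite G]
    {V : Type*} [AddCommGroup V] [Module ℚ V] [FiniteDimensional ℚ V]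
    (ρ : Representation ℚ G V)
    (I D : Subgroup G) (hID : I ≤ D)
    [(I.subgroupOf D).Normal]
    (hcyc : IsCyclic (D ⧸ I.subgroupOf D)) :
    -- V^I is stable under ρ d for d ∈ D
    (∀ d ∈ D, ∀ v ∈ Representation.invariants (ρ.comp I.subtype),
        ρ d v ∈ Representation.invariants (ρ.comp I.subtype)) ∧
    -- the induced action of D on V^I factors through D/I
    (∀ (d d' : G) (hd : d ∈ D) (hd' : d' ∈ D),
      (QuotientGroup.mk (⟨d, hd⟩ : D) : D ⧸ I.subgroupOf D) =
          QuotientGroup.mk (⟨d', hd'⟩ : D) →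
      ∀ v ∈ Representation.invariants (ρ.comp I.subtype), ρ d v = ρ d' v) ∧
    -- independence of the characteristic polynomial of ρ g restricted to V^I,
    -- for g ∈ D whose image generates D/I
    (∀ (g g' : G) (hg : g ∈ D) (hg' : g' ∈ D),
      Subgroup.zpowers (QuotientGroup.mk (⟨g, hg⟩ : D) : D ⧸ I.subgroupOf D) = ⊤ →
      Subgroup.zpowers (QuotientGroup.mk (⟨g', hg'⟩ : D) : D ⧸ I.subgroupOf D) = ⊤ →
      ∀ (h₁ : ∀ v ∈ Representation.invariants (ρ.comp I.subtype),
          ρ g v ∈ Representation.invariants (ρ.comp I.subtype))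
        (h₂ : ∀ v ∈ Representation.invariants (ρ.comp I.subtype),
          ρ g' v ∈ Representation.invariants (ρ.comp I.subtype)),
        ((ρ g).restrict h₁).charpoly = ((ρ g').restrict h₂).charpoly) := by
  have stab : ∀ d ∈ D, ∀ v ∈ Representation.invariants (ρ.comp I.subtype),
        ρ d v ∈ Representation.invariants (ρ.comp I.subtype) := by
    intro d hd v hv
    rw [Representation.mem_invariants] at hv ⊢
    rintro ⟨i, hi⟩
    have hn := ‹(I.subgroupOf D).Normal›.conj_mem ⟨i, hID hi⟩
      (Subgroup.mem_subgroupOf.mpr hi) (⟨d, hd⟩⁻¹)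
    have hn' : d⁻¹ * i * d ∈ I := by simpa [Subgroup.mem_subgroupOf] using hn
    have h := hv ⟨_, hn'⟩
    change ρ (d⁻¹ * i * d) v = v at h
    change ρ i (ρ d v) = ρ d v
    conv_rhs => rw [← h]
    rw [← Module.End.mul_apply, ← Module.End.mul_apply, ← map_mul, ← map_mul]
    congr 2
    group
  have fac : ∀ (d d' : G) (hd : d ∈ D) (hd' : d' ∈ D),
      (QuotientGroup.mk (⟨d, hd⟩ : D) : D ⧸ I.subgroupOf D) =
          QuotientGroup.mk (⟨d', hd'⟩ : D) →
      ∀ v ∈ Representation.invariants (ρ.comp I.subtype), ρ d v = ρ d' v := by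
    intro d d' hd hd' h v hv
    rw [QuotientGroup.eq] at h
    have hi : d⁻¹ * d' ∈ I := by simpa [Subgroup.mem_subgroupOf] using h
    have h := (Representation.mem_invariants _ _).mp hv ⟨_, hi⟩
    change ρ (d⁻¹ * d') v = v at h
    conv_lhs => rw [← h]
    rw [← Module.End.mul_apply, ← map_mul, mul_inv_cancel_left]
  refine ⟨stab, fac, ?_⟩
  intro g g' hg hg' hgen hgen' h₁ h₂
  set q : D ⧸ I.subgroupOf D := QuotientGroup.mk (⟨g, hg⟩ : D) with hq
  set q' : D ⧸ I.subgroupOf D := QuotientGroup.mk (⟨g', hg'⟩ : D) with hq'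
  have ho := orderOf_eq_card_of_zpowers_eq_top hgen
  have ho' := orderOf_eq_card_of_zpowers_eq_top hgen'
  have hpos : 0 < orderOf q := orderOf_pos q
  obtain ⟨m, hm⟩ : ∃ m : ℕ, q ^ m = q' := by
    have : q' ∈ Subgroup.zpowers q := hgen ▸ Subgroup.mem_top _
    exact (mem_powers_iff_mem_zpowers.mpr this)
  have hcop : m.Coprime (orderOf q) := by
    have h := orderOf_pow q (n := m)
    rw [hm, ho', ← ho] at h
    rw [Nat.coprime_comm]
    exact (Nat.div_eq_self.mp h.symm).resolve_left hpos.ne'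
  have key : ∀ k (v : Representation.invariants (ρ.comp I.subtype)),
      ((((ρ g).restrict h₁) ^ k) v : V) = ρ (g ^ k) v := by
    intro k v
    induction k with
    | zero => simp
    | succ k ih =>
      rw [pow_succ', Module.End.mul_apply, LinearMap.coe_restrict_apply, ih, pow_succ', map_mul,
        Module.End.mul_apply]
  have hn : ((ρ g).restrict h₁) ^ (orderOf q) = 1 := by
    ext v
    rw [key, fac (g ^ orderOf q) 1 (D.pow_mem hg _) D.one_mem _ v v.2]
    · simp
    · exact pow_orderOf_eq_one q
  rw [charpoly_pow_of_coprime _ _ m hpos.ne' hcop hn]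
  congr 1
  ext v
  rw [key, fac (g ^ m) g' (D.pow_mem hg _) hg' _ v v.2]
  · rfl
  · exact hm
end
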